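/- Suppose K is of type D with constant m and let s ≥ m be a natural number. Then the element (1 + ε_m)^{2^s} of K̄ lies in K, and K_s = ⟨(1 + ε_m)^{2^s}⟩ · K*^{2^s}, i.e. an element a ∈ K* satisfies a = α^{2^s} for some α ∈ K(ε_2)* if and only if a = (1 + ε_m)^{2^s·k} · b^{2^s} for some integer k and some b ∈ K*. -/

import Mathlib

noncomputable section

/-- `x ∈ K̄` lies in (the image of) the base field `K`. -/
def InK (K : Type*) [Field K] (x : AlgebraicClosure K) : Prop :=
  x ∈ Set.range (algebraMap K (AlgebraicClosure K))

/-- Type A: `ε₂ ∈ K` and `εₙ ∈ K` for every `n`. -/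
def TypeA (K : Type*) [Field K] (ε : ℕ → AlgebraicClosure K) : Prop :=
  InK K (ε 2) ∧ ∀ n : ℕ, InK K (ε n)

/-- Type B: `ε₂ ∈ K` and there is a unique `m ≥ 2` with `ε_m ∈ K`, `ε_{m+1} ∉ K`. -/
def TypeB (K : Type*) [Field K] (ε : ℕ → AlgebraicClosure K) : Prop :=
  InK K (ε 2) ∧ ∃! m : ℕ, 2 ≤ m ∧ InK K (ε m) ∧ ¬InK K (ε (m + 1))

/-- Type C: `ε₂ ∉ K` and `εₙ + εₙ⁻¹ ∈ K` for every `n`. -/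
def TypeC (K : Type*) [Field K] (ε : ℕ → AlgebraicClosure K) : Prop :=
  ¬InK K (ε 2) ∧ ∀ n : ℕ, InK K (ε n + (ε n)⁻¹)

/-- Type D: `ε₂ ∉ K` and there is a unique `m ≥ 2` with `ε_m + ε_m⁻¹ ∈ K`,
`ε_{m+1} + ε_{m+1}⁻¹ ∉ K` and `ε_{m+1} - ε_{m+1}⁻¹ ∉ K`. -/
def TypeD (K : Type*) [Field K] (ε : ℕ → AlgebraicClosure K) : Prop :=
  ¬InK K (ε 2) ∧ ∃! m : ℕ, 2 ≤ m ∧ InK K (ε m + (ε m)⁻¹) ∧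
    ¬InK K (ε (m + 1) + (ε (m + 1))⁻¹) ∧ ¬InK K (ε (m + 1) - (ε (m + 1))⁻¹)

/-- Type E: `ε₂ ∉ K` and there is a unique `m ≥ 3` with `ε_m - ε_m⁻¹ ∈ K`. -/
def TypeE (K : Type*) [Field K] (ε : ℕ → AlgebraicClosure K) : Prop :=
  ¬InK K (ε 2) ∧ ∃! m : ℕ, 3 ≤ m ∧ InK K (ε m - (ε m)⁻¹)

/-- Type B with constant `m`. -/
def TypeBc (K : Type*) [Field K] (ε : ℕ → AlgebraicClosure K) (m : ℕ) : Prop :=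
  InK K (ε 2) ∧ 2 ≤ m ∧ InK K (ε m) ∧ ¬InK K (ε (m + 1))

/-- Type D with constant `m`. -/
def TypeDc (K : Type*) [Field K] (ε : ℕ → AlgebraicClosure K) (m : ℕ) : Prop :=
  ¬InK K (ε 2) ∧ 2 ≤ m ∧ InK K (ε m + (ε m)⁻¹) ∧
    ¬InK K (ε (m + 1) + (ε (m + 1))⁻¹) ∧ ¬InK K (ε (m + 1) - (ε (m + 1))⁻¹)

/-- Type E with constant `m`. -/
def TypeEc (K : Type*) [Field K] (ε : ℕ → AlgebraicClosure K) (m : ℕ) : Prop :=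
  ¬InK K (ε 2) ∧ 3 ≤ m ∧ InK K (ε m - (ε m)⁻¹)

/-- `a ∈ K_s = K* ∩ (K(ε₂)*)^{2^s}`: `a = α^{2^s}` for some `α ∈ K(ε₂)*`. -/
def MemKs (K : Type*) [Field K] (ε : ℕ → AlgebraicClosure K) (s : ℕ) (a : K) : Prop :=
  ∃ α : AlgebraicClosure K, α ∈ IntermediateField.adjoin K {ε 2} ∧ α ≠ 0 ∧
    algebraMap K (AlgebraicClosure K) a = α ^ 2 ^ s

/-- A minimal idempotent of a commutative ring: a nonzero idempotent which is not
the sum of two nonzero orthogonal idempotents. -/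
def IsMinIdem {A : Type*} [CommRing A] (e : A) : Prop :=
  e ≠ 0 ∧ e * e = e ∧
    ¬∃ e₁ e₂ : A, e₁ ≠ 0 ∧ e₂ ≠ 0 ∧ e₁ * e₁ = e₁ ∧ e₂ * e₂ = e₂ ∧
      e₁ * e₂ = 0 ∧ e = e₁ + e₂

/-- An element of `K(i)`, where `i² = -1`, has the form `p + q i`. -/
theorem exists_eq_add_mul_of_mem_adjoin {K E : Type*} [Field K] [Field E] [Algebra K E] {i x : E}
    (hi : i ^ 2 = -1) (hx : x ∈ IntermediateField.adjoin K {i}) :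
    ∃ p q : K, x = algebraMap K E p + algebraMap K E q * i := by
  have hint : IsIntegral K i := by
    refine ⟨Polynomial.X ^ 2 + 1, by monicity!, ?_⟩
    simp [hi]
  rw [← IntermediateField.mem_toSubalgebra,
    IntermediateField.adjoin_simple_toSubalgebra_of_isAlgebraic hint.isAlgebraic] at hx
  induction hx using Algebra.adjoin_induction with
  | mem x hx => exact ⟨0, 1, by simpa using hx⟩
  | algebraMap r => exact ⟨r, 0, by simp⟩
  | add x y _ _ hx hy =>
    obtain ⟨p, q, rfl⟩ := hx
    obtain ⟨p', q', rfl⟩ := hy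
    exact ⟨p + p', q + q', by simp only [map_add]; ring⟩
  | mul x y _ _ hx hy =>
    obtain ⟨p, q, rfl⟩ := hx
    obtain ⟨p', q', rfl⟩ := hy
    refine ⟨p * p' - q * q', p * q' + q * p', ?_⟩
    simp only [map_add, map_sub, map_mul]
    linear_combination (algebraMap K E q * algebraMap K E q') * hi

/-- If `i ∉ K` and `i² = -1`, some automorphism of `K̄` over `K` sends `i` to `-i`. -/
theorem exists_algEquiv_map_eq_neg {K : Type*} [Field K] (h2 : (2 : K) ≠ 0)
    {i : AlgebraicClosure K} (hi : i ^ 2 = -1) (hiK : ¬InK K i) :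
    ∃ σ : AlgebraicClosure K ≃ₐ[K] AlgebraicClosure K, σ i = -i := by
  have hsep : IsSeparable K i := by
    have h : (Polynomial.X ^ 2 - Polynomial.C (-1 : K)).Separable :=
      Polynomial.separable_X_pow_sub_C (-1) (by exact_mod_cast h2) (by simp)
    exact h.of_dvd (minpoly.dvd K i (by simp [hi]))
  obtain ⟨y, hne, hy⟩ := (notMem_iff_exists_ne_and_isConjRoot hsep
    (IsAlgClosed.splits _)).1 (show i ∉ (⊥ : Subalgebra K _) from
      fun h => hiK (Algebra.mem_bot.1 h))
  obtain ⟨σ, rfl⟩ := isConjRoot_iff_exists_algEquiv.1 hy.symm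
  refine ⟨σ, ?_⟩
  have hsq : (σ i) ^ 2 = i ^ 2 := by rw [← map_pow, hi]; simp
  exact (sq_eq_sq_iff_eq_or_eq_neg.1 hsq).resolve_left fun h => hne h.symm

/-- An element of `K(i)` fixed by an automorphism sending `i` to `-i` lies in `K`. -/
theorem inK_of_mem_adjoin_of_map_eq {K : Type*} [Field K] (h2 : (2 : K) ≠ 0)
    {i x : AlgebraicClosure K} (hi : i ^ 2 = -1)
    (σ : AlgebraicClosure K ≃ₐ[K] AlgebraicClosure K) (hσ : σ i = -i)
    (hx : x ∈ IntermediateField.adjoin K {i}) (hfix : σ x = x) : InK K x := by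
  obtain ⟨p, q, rfl⟩ := exists_eq_add_mul_of_mem_adjoin hi hx
  have hi0 : i ≠ 0 := by rintro rfl; simp at hi
  have h2' : (2 : AlgebraicClosure K) ≠ 0 := by
    rw [← map_ofNat (algebraMap K (AlgebraicClosure K)) 2]
    exact (map_ne_zero _).2 h2
  simp only [map_add, map_mul, AlgEquiv.commutes, hσ] at hfix
  have : 2 * (algebraMap K (AlgebraicClosure K) q * i) = 0 := by linear_combination -hfix
  simp only [mul_eq_zero, h2', hi0, or_false, false_or] at this
  exact ⟨p, by simp [this]⟩

/-- Powers of an invertible element `z` with `z + z⁻¹ ∈ K` have the form `p + q z`. -/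
theorem exists_pow_eq_add_mul {K E : Type*} [Field K] [Field E] [Algebra K E] {z : E} {c : K}
    (hz : z ≠ 0) (hc : algebraMap K E c = z + z⁻¹) (n : ℕ) :
    ∃ p q : K, z ^ n = algebraMap K E p + algebraMap K E q * z := by
  induction n with
  | zero => exact ⟨1, 0, by simp⟩
  | succ n ih =>
    obtain ⟨p, q, h⟩ := ih
    refine ⟨-q, p + q * c, ?_⟩
    rw [pow_succ, h]
    simp only [map_neg, map_add, map_mul, hc]
    field_simp
    ring

theorem pow_two_pow_eq {M : Type*} [Monoid M] {ε : ℕ → M}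
    (hcomp : ∀ n : ℕ, ε (n + 1) ^ 2 = ε n) (n k : ℕ) : ε (n + k) ^ 2 ^ k = ε n := by
  induction k with
  | zero => simp
  | succ k ih => rw [pow_succ', pow_mul, ← add_assoc, hcomp, ih]

theorem one_add_sq_eq {E : Type*} [Field E] {z : E} (hz : z ≠ 0) :
    (1 + z) ^ 2 = z * (z + z⁻¹ + 2) := by
  field_simp
  ring

/-- If `ε_{m+1} ∉ L`, every 2-power root of unity in `L` is a power of `ε_m`. -/
theorem exists_pow_eq_of_pow_two_pow_eq_one {K E : Type*} [Field K] [Field E] [Algebra K E]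
    (L : IntermediateField K E) {ε : ℕ → E} {m : ℕ}
    (hm : IsPrimitiveRoot (ε m) (2 ^ m)) (hm' : IsPrimitiveRoot (ε (m + 1)) (2 ^ (m + 1)))
    (hL : ε (m + 1) ∉ L) {z : E} (hzL : z ∈ L) {s : ℕ} (hz : z ^ 2 ^ s = 1) :
    ∃ j : ℕ, ε m ^ j = z := by
  obtain ⟨t, -, ht⟩ := (Nat.dvd_prime_pow Nat.prime_two).1 (orderOf_dvd_of_pow_eq_one hz)
  have hprim : IsPrimitiveRoot z (2 ^ t) := ht ▸ IsPrimitiveRoot.orderOf z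
  have htm : t ≤ m := by
    by_contra! h
    obtain ⟨d, rfl⟩ := Nat.exists_eq_add_of_lt h
    have hp : IsPrimitiveRoot (z ^ 2 ^ d) (2 ^ (m + 1)) :=
      hprim.pow (by positivity) (by ring)
    obtain ⟨j, -, hj⟩ := hp.eq_pow_of_pow_eq_one hm'.pow_eq_one
    exact hL (hj ▸ pow_mem (pow_mem hzL _) _)
  have hz' : z ^ 2 ^ m = 1 := by
    obtain ⟨d, rfl⟩ := Nat.exists_eq_add_of_le htm
    rw [pow_add, pow_mul, hprim.pow_eq_one, one_pow]
  obtain ⟨j, -, hj⟩ := hm.eq_pow_of_pow_eq_one hz'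
  exact ⟨j, hj⟩

/-- Lemma 3, case 4): if `K` is of type D with constant `m` and `s ≥ m`, then
`(1 + ε_m)^{2^s} ∈ K` and `K_s = ⟨(1 + ε_m)^{2^s}⟩ · K*^{2^s}`. -/
theorem stmt_9 (K : Type*) [Field K] (h2 : (2 : K) ≠ 0)
    (ε : ℕ → AlgebraicClosure K)
    (hprim : ∀ n : ℕ, IsPrimitiveRoot (ε n) (2 ^ n))
    (hcomp : ∀ n : ℕ, ε (n + 1) ^ 2 = ε n)
    (m : ℕ) (hD : TypeDc K ε m) (s : ℕ) (hs : m ≤ s) :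
    ∃ w : K, algebraMap K (AlgebraicClosure K) w = (1 + ε m) ^ 2 ^ s ∧
      ∀ a : K, a ≠ 0 →
        (MemKs K ε s a ↔ ∃ (k : ℤ) (b : K), b ≠ 0 ∧ a = w ^ k * b ^ 2 ^ s) := by
  obtain ⟨hi2, hm2, ⟨c, hc⟩, hplus, hminus⟩ := hD
  set F := algebraMap K (AlgebraicClosure K) with hF
  set L := IntermediateField.adjoin K {ε 2}
  have hε0 (n : ℕ) : ε n ≠ 0 := (hprim n).ne_zero (by positivity)
  have hi : ε 2 ^ 2 = -1 := by
    rw [hcomp 1]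
    exact IsPrimitiveRoot.eq_neg_one_of_two_right (by simpa using hprim 1)
  have hFL (x : K) : F x ∈ L := L.algebraMap_mem x
  have hmL : ε m ∈ L := by
    obtain ⟨k, rfl⟩ := Nat.exists_eq_add_of_le hm2
    obtain ⟨p, q, h⟩ := exists_pow_eq_add_mul (hε0 _) hc (2 ^ k)
    rw [pow_two_pow_eq hcomp] at h
    have hq : F q ≠ 0 := fun hq => hi2 ⟨p, by rw [h, ← hF, hq]; simp [hF]⟩
    have : ε (2 + k) = (ε 2 - F p) / F q := by
      rw [eq_div_iff hq, h]
      ring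
    rw [this]
    exact div_mem (sub_mem (IntermediateField.mem_adjoin_simple_self K _) (hFL p)) (hFL q)
  obtain ⟨σ, hσ⟩ := exists_algEquiv_map_eq_neg h2 hi hi2
  have hfix {x : AlgebraicClosure K} (hx : x ∈ L) (h : σ x = x) : InK K x :=
    inK_of_mem_adjoin_of_map_eq h2 hi σ hσ hx h
  have hσL {x : AlgebraicClosure K} (hx : x ∈ L) : σ x ∈ L := by
    obtain ⟨p, q, rfl⟩ := exists_eq_add_mul_of_mem_adjoin hi hx
    simp only [map_add, map_mul, AlgEquiv.commutes, hσ]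
    exact add_mem (hFL p) (mul_mem (hFL q)
      (neg_mem (IntermediateField.mem_adjoin_simple_self K _)))
  have hmK : ¬InK K (ε m) := by
    rintro ⟨x, hx⟩
    obtain ⟨k, rfl⟩ := Nat.exists_eq_add_of_le hm2
    exact hi2 ⟨x ^ 2 ^ k, by rw [map_pow, hx, pow_two_pow_eq hcomp]⟩
  have hσm : σ (ε m) = (ε m)⁻¹ := by
    have h : σ (ε m) + (σ (ε m))⁻¹ = ε m + (ε m)⁻¹ := by
      rw [← map_inv₀, ← map_add, ← hc, AlgEquiv.commutes]
    have hne : σ (ε m) - ε m ≠ 0 := fun h => hmK (hfix hmL (sub_eq_zero.1 h))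
    have hσ0 : σ (ε m) ≠ 0 := (map_ne_zero σ).2 (hε0 m)
    have h0 := hε0 m
    rw [← mul_eq_one_iff_eq_inv₀ h0]
    apply mul_left_cancel₀ hne
    field_simp at h
    linear_combination h
  have hm1L : ε (m + 1) ∉ L := by
    intro hmem
    have hsq : σ (ε (m + 1)) ^ 2 = (ε (m + 1))⁻¹ ^ 2 := by
      rw [← map_pow, hcomp, hσm, inv_pow, hcomp]
    rcases sq_eq_sq_iff_eq_or_eq_neg.1 hsq with h | h
    · refine hplus (hfix (add_mem hmem (inv_mem hmem)) ?_)
      rw [map_add, map_inv₀, h, inv_inv, add_comm]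
    · refine hminus (hfix (sub_mem hmem (inv_mem hmem)) ?_)
      rw [map_sub, map_inv₀, h, inv_neg, inv_inv]
      ring
  have hu0 : 1 + ε m ≠ 0 := fun h =>
    hmK ⟨-1, by rw [map_neg, map_one]; linear_combination -h⟩
  have huL : 1 + ε m ∈ L := add_mem (one_mem L) hmL
  have hσu : σ (1 + ε m) * ε m = 1 + ε m := by
    rw [map_add, map_one, hσm, add_mul, inv_mul_cancel₀ (hε0 m)]
    ring
  obtain ⟨w, hw⟩ : ∃ w : K, F w = (1 + ε m) ^ 2 ^ s := by
    obtain ⟨k, rfl⟩ := Nat.exists_eq_add_of_le' (show 1 ≤ s by omega)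
    have hsq : (ε m ^ 2 ^ k) ^ 2 = 1 := by
      obtain ⟨d, hd⟩ := Nat.exists_eq_add_of_le hs
      rw [← pow_mul, ← pow_succ, hd, pow_add, pow_mul, (hprim m).pow_eq_one, one_pow]
    have key : (1 + ε m) ^ 2 ^ (k + 1) = ε m ^ 2 ^ k * F ((c + 2) ^ 2 ^ k) := by
      rw [pow_succ', pow_mul, one_add_sq_eq (hε0 m), ← hc, mul_pow, map_pow, map_add, map_ofNat]
    rcases eq_or_eq_neg_of_sq_eq_sq _ 1 (hsq.trans (one_pow 2).symm) with h | h
    · exact ⟨(c + 2) ^ 2 ^ k, by rw [key, h, one_mul]⟩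
    · exact ⟨-(c + 2) ^ 2 ^ k, by rw [key, h, map_neg, neg_one_mul]⟩
  refine ⟨w, hw, fun a ha => ⟨?_, ?_⟩⟩
  · rintro ⟨α, hαL, hα0, hα⟩
    have hroot : (σ α / α) ^ 2 ^ s = 1 := by
      rw [div_pow, ← map_pow, ← hα, AlgEquiv.commutes, div_self]
      exact (map_ne_zero _).2 ha
    obtain ⟨j, hj⟩ := exists_pow_eq_of_pow_two_pow_eq_one L (hprim m) (hprim (m + 1)) hm1L
      (div_mem (hσL hαL) hαL) hroot
    obtain ⟨b, hb⟩ := hfix (mul_mem hαL (pow_mem huL j)) (by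
      have hσα : σ α = ε m ^ j * α := by rw [hj, div_mul_cancel₀ _ hα0]
      rw [map_mul, map_pow, hσα]
      conv_rhs => rw [← hσu, mul_pow]
      ring)
    have hw0 : w ≠ 0 := by
      rintro rfl
      exact pow_ne_zero _ hu0 (by rw [← hw, map_zero])
    have hab : a * w ^ j = b ^ 2 ^ s := by
      apply (algebraMap K (AlgebraicClosure K)).injective
      rw [map_mul, map_pow, map_pow, hb, hα, ← hF, hw]
      ring
    refine ⟨-j, b, ?_, ?_⟩
    · rintro rfl
      exact mul_ne_zero hα0 (pow_ne_zero j hu0) (by rw [← hb, map_zero])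
    · rw [← hab, zpow_neg, zpow_natCast]
      field_simp
  · rintro ⟨k, b, hb, rfl⟩
    refine ⟨(1 + ε m) ^ k * F b, mul_mem (zpow_mem huL k) (hFL b),
      mul_ne_zero (zpow_ne_zero k hu0) ((map_ne_zero F).2 hb), ?_⟩
    rw [← hF, map_mul, map_pow, map_zpow₀, hw, mul_pow, ← zpow_natCast, ← zpow_mul,
      ← zpow_natCast ((1 + ε m) ^ k), ← zpow_mul, mul_comm k]
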